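/- arXiv:0912.5209 — 5 statements merged into one kernel-verified Lean document; each statement's English description precedes it below -/
import Mathlib

section
/- For every h-normal Γ-linear connection of Cartan type, the following local Bianchi identities hold for all indices l, i, j, k: (1) A_{j,k}{ R^l_j1k + (T^l_1j)_|k + Rv^r_1j C^l_kr } = 0, and (2) Σ_{i,j,k}{ R^l_ijk − Rv^r_ij C^l_kr } = 0. -/
open Finset

noncomputable section

namespace Jet

/-- Smooth real-valued functions of `(t, x, y) ∈ ℝ × ℝⁿ × ℝⁿ`, the local coordinates
of the 1-jet space `J¹(ℝ, M)`. -/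
abbrev Fn (n : ℕ) : Type := ℝ → (Fin n → ℝ) → (Fin n → ℝ) → ℝ

def Smooth {n : ℕ} (F : Fn n) : Prop :=
  ContDiff ℝ (⊤ : ℕ∞) (fun p : ℝ × (Fin n → ℝ) × (Fin n → ℝ) => F p.1 p.2.1 p.2.2)

/-- Partial derivative in the time variable `t`. -/
def pt {n : ℕ} (F : Fn n) : Fn n := fun t x y => deriv (fun s => F s x y) t

/-- Partial derivative in the spatial variable `xⁱ`. -/
def px {n : ℕ} (i : Fin n) (F : Fn n) : Fn n :=
  fun t x y => deriv (fun s => F t (Function.update x i s) y) (x i)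

/-- Partial derivative in the fibre variable `yⁱ`. -/
def py {n : ℕ} (i : Fin n) (F : Fn n) : Fn n :=
  fun t x y => deriv (fun s => F t x (Function.update y i s)) (y i)

/-- Kronecker delta, as a constant function on the jet space. -/
def kron {n : ℕ} (i j : Fin n) : Fn n := if i = j then 1 else 0

/-- The coordinate function `yⁱ`. -/
def yc {n : ℕ} (i : Fin n) : Fn n := fun _ _ y => y i

/-- The Christoffel symbol `κ(t) = (1/(2h)) dh/dt` of a Riemannian metric `h` on `ℝ`,
as a function on the jet space. -/
def chr {n : ℕ} (h : ℝ → ℝ) : Fn n := fun t _ _ => deriv h t / (2 * h t)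

/-- The metric `h(t)` as a function on the jet space. -/
def hfun {n : ℕ} (h : ℝ → ℝ) : Fn n := fun t _ _ => h t

/-- The derivative `dh/dt` as a function on the jet space. -/
def hder {n : ℕ} (h : ℝ → ℝ) : Fn n := fun t _ _ => deriv h t

variable {n : ℕ}

/-- The adapted temporal derivative `δ/δt = ∂/∂t − Mʳ ∂/∂yʳ` determined by a
nonlinear connection `(M, N)`. -/
def dt (M : Fin n → Fn n) (F : Fn n) : Fn n := pt F - ∑ r, M r * py r F

/-- The adapted spatial derivative `δ/δxᵏ = ∂/∂xᵏ − Nʳₖ ∂/∂yʳ`. -/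
def dx (N : Fin n → Fin n → Fn n) (k : Fin n) (F : Fn n) : Fn n :=
  px k F - ∑ r, N r k * py r F

/-- An `h`-normal `Γ`-linear connection `(κ, Gᵏᵢ, Lᵏᵢⱼ, Cᵏᵢⱼ)`. -/
structure Conn (n : ℕ) where
  κ : Fn n
  G : Fin n → Fin n → Fn n
  L : Fin n → Fin n → Fin n → Fn n
  C : Fin n → Fin n → Fin n → Fn n

/-! ### Torsion d-tensors -/

/-- `Tʳ₁ⱼ = −Gʳⱼ`. -/
def T1 (Γ : Conn n) (r j : Fin n) : Fn n := -Γ.G r j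

/-- `Rvʳ₁ⱼ = (δ/δxʲ)Mʳ − (δ/δt)Nʳⱼ`. -/
def Rv1 (M : Fin n → Fn n) (N : Fin n → Fin n → Fn n) (r j : Fin n) : Fn n :=
  dx N j (M r) - dt M (N r j)

/-- `Tʳᵢⱼ = Lʳᵢⱼ − Lʳⱼᵢ`. -/
def Tsp (Γ : Conn n) (r i j : Fin n) : Fn n := Γ.L r i j - Γ.L r j i

/-- `Rvʳᵢⱼ = (δ/δxʲ)Nʳᵢ − (δ/δxⁱ)Nʳⱼ`. -/
def Rvsp (M : Fin n → Fn n) (N : Fin n → Fin n → Fn n) (r i j : Fin n) : Fn n :=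
  dx N j (N r i) - dx N i (N r j)

/-- `Pvʳ₁ⱼ = ∂Mʳ/∂yʲ − Gʳⱼ + δʳⱼ κ`. -/
def Pv1 (M : Fin n → Fn n) (Γ : Conn n) (r j : Fin n) : Fn n :=
  py j (M r) - Γ.G r j + kron r j * Γ.κ

/-- `Phʳᵢⱼ = Cʳᵢⱼ`. -/
def Phsp (Γ : Conn n) (r i j : Fin n) : Fn n := Γ.C r i j

/-- `Pvʳᵢⱼ = ∂Nʳᵢ/∂yʲ − Lʳⱼᵢ`. -/
def Pvsp (N : Fin n → Fin n → Fn n) (Γ : Conn n) (r i j : Fin n) : Fn n :=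
  py j (N r i) - Γ.L r j i

/-- `Sʳᵢⱼ = Cʳᵢⱼ − Cʳⱼᵢ`. -/
def Ssp (Γ : Conn n) (r i j : Fin n) : Fn n := Γ.C r i j - Γ.C r j i

/-! ### Generic covariant derivatives of d-tensors -/

/-- Index types of the (valued) indices of a d-tensor: upper/lower spatial,
upper/lower vertical.  (Temporal indices carry no value; they are accounted for by the
temporal weight `p` = number of upper temporal indices minus number of lower temporal
indices.) -/
inductive IdxType | uS | lS | uV | lV

/-- A d-tensor component family with `m` valued indices. -/
abbrev Tensor (n m : ℕ) := (Fin m → Fin n) → Fn n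

/-- The `ℝ`-horizontal covariant derivative `D_{/1}` of a d-tensor `D` with valued index
signature `σ` and temporal weight `p`. -/
def covT {m : ℕ} (M : Fin n → Fn n) (Γ : Conn n) (p : ℤ) (σ : Fin m → IdxType)
    (D : Tensor n m) : Tensor n m := fun a =>
  dt M (D a) + p • (Γ.κ * D a)
    + ∑ q : Fin m,
      (match σ q with
      | .uS => ∑ r, D (Function.update a q r) * Γ.G (a q) r
      | .lS => -∑ r, D (Function.update a q r) * Γ.G r (a q)
      | .uV => ∑ r, D (Function.update a q r) * (Γ.G (a q) r - kron (a q) r * Γ.κ)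
      | .lV => -∑ r, D (Function.update a q r) * (Γ.G r (a q) - kron r (a q) * Γ.κ) : Fn n)

/-- The `M`-horizontal covariant derivative `D_{|k}`. -/
def covX {m : ℕ} (N : Fin n → Fin n → Fn n) (Γ : Conn n) (σ : Fin m → IdxType)
    (k : Fin n) (D : Tensor n m) : Tensor n m := fun a =>
  dx N k (D a)
    + ∑ q : Fin m,
      (match σ q with
      | .uS => ∑ r, D (Function.update a q r) * Γ.L (a q) r k
      | .uV => ∑ r, D (Function.update a q r) * Γ.L (a q) r k
      | .lS => -∑ r, D (Function.update a q r) * Γ.L r (a q) k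
      | .lV => -∑ r, D (Function.update a q r) * Γ.L r (a q) k : Fn n)

/-- The vertical covariant derivative `D|_{(k)}`. -/
def covY {m : ℕ} (Γ : Conn n) (σ : Fin m → IdxType)
    (k : Fin n) (D : Tensor n m) : Tensor n m := fun a =>
  py k (D a)
    + ∑ q : Fin m,
      (match σ q with
      | .uS => ∑ r, D (Function.update a q r) * Γ.C (a q) r k
      | .uV => ∑ r, D (Function.update a q r) * Γ.C (a q) r k
      | .lS => -∑ r, D (Function.update a q r) * Γ.C r (a q) k
      | .lV => -∑ r, D (Function.update a q r) * Γ.C r (a q) k : Fn n)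

/-- The coefficients `Cᵏᵢⱼ` viewed as a d-tensor with signature
(upper spatial, lower spatial, lower vertical). -/
def CT (Γ : Conn n) : Tensor n 3 := fun a => Γ.C (a 0) (a 1) (a 2)

/-- The signature of `Cᵏᵢⱼ`. -/
def sigC : Fin 3 → IdxType := ![IdxType.uS, IdxType.lS, IdxType.lV]

/-! ### Curvature d-tensors -/

/-- `Rˡᵢ₁ₖ`. -/
def Rc1 (M : Fin n → Fn n) (N : Fin n → Fin n → Fn n) (Γ : Conn n) (l i k : Fin n) : Fn n :=
  dx N k (Γ.G l i) - dt M (Γ.L l i k) + ∑ r, Γ.G r i * Γ.L l r k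
    - ∑ r, Γ.L r i k * Γ.G l r + ∑ r, Γ.C l i r * Rv1 M N r k

/-- `Rˡᵢⱼₖ`. -/
def Rc (M : Fin n → Fn n) (N : Fin n → Fin n → Fn n) (Γ : Conn n) (l i j k : Fin n) : Fn n :=
  dx N k (Γ.L l i j) - dx N j (Γ.L l i k) + ∑ r, Γ.L r i j * Γ.L l r k
    - ∑ r, Γ.L r i k * Γ.L l r j + ∑ r, Γ.C l i r * Rvsp M N r j k

/-- `Pˡᵢ₁₍ₖ₎`. -/
def Pc1 (M : Fin n → Fn n) (N : Fin n → Fin n → Fn n) (Γ : Conn n) (l i k : Fin n) : Fn n :=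
  py k (Γ.G l i) - covT M Γ 0 sigC (CT Γ) ![l, i, k] + ∑ r, Γ.C l i r * Pv1 M Γ r k

/-- `Pˡᵢⱼ₍ₖ₎`. -/
def Pc (M : Fin n → Fn n) (N : Fin n → Fin n → Fn n) (Γ : Conn n) (l i j k : Fin n) : Fn n :=
  py k (Γ.L l i j) - covX N Γ sigC j (CT Γ) ![l, i, k] + ∑ r, Γ.C l i r * Pvsp N Γ r j k

/-- `Sˡᵢ₍ⱼ₎₍ₖ₎`. -/
def Sc (Γ : Conn n) (l i j k : Fin n) : Fn n :=
  py k (Γ.C l i j) - py j (Γ.C l i k)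
    + ∑ r, Γ.C r i j * Γ.C l r k - ∑ r, Γ.C r i k * Γ.C l r j

end Jet

namespace Jet

variable {n : ℕ}

/-- A family with one valued index, viewed as a d-tensor. -/
def famT (X : Fin n → Fn n) : Tensor n 1 := fun a => X (a 0)

def T1T (Γ : Conn n) : Tensor n 2 := fun a => T1 Γ (a 0) (a 1)
def Rv1T (M : Fin n → Fn n) (N : Fin n → Fin n → Fn n) : Tensor n 2 :=
  fun a => Rv1 M N (a 0) (a 1)
def RvspT (M : Fin n → Fn n) (N : Fin n → Fin n → Fn n) : Tensor n 3 :=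
  fun a => Rvsp M N (a 0) (a 1) (a 2)
def Pv1T (M : Fin n → Fn n) (Γ : Conn n) : Tensor n 2 := fun a => Pv1 M Γ (a 0) (a 1)
def PvspT (N : Fin n → Fin n → Fn n) (Γ : Conn n) : Tensor n 3 :=
  fun a => Pvsp N Γ (a 0) (a 1) (a 2)
def Rc1T (M : Fin n → Fn n) (N : Fin n → Fin n → Fn n) (Γ : Conn n) : Tensor n 3 :=
  fun a => Rc1 M N Γ (a 0) (a 1) (a 2)
def RcT (M : Fin n → Fn n) (N : Fin n → Fin n → Fn n) (Γ : Conn n) : Tensor n 4 :=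
  fun a => Rc M N Γ (a 0) (a 1) (a 2) (a 3)
def Pc1T (M : Fin n → Fn n) (N : Fin n → Fin n → Fn n) (Γ : Conn n) : Tensor n 3 :=
  fun a => Pc1 M N Γ (a 0) (a 1) (a 2)
def PcT (M : Fin n → Fn n) (N : Fin n → Fin n → Fn n) (Γ : Conn n) : Tensor n 4 :=
  fun a => Pc M N Γ (a 0) (a 1) (a 2) (a 3)
def ScT (Γ : Conn n) : Tensor n 4 := fun a => Sc Γ (a 0) (a 1) (a 2) (a 3)

/-- valued-index signatures (temporal indices are tracked by the weight `p` only) -/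
def sig0 : Fin 0 → IdxType := ![]
def siglS : Fin 1 → IdxType := ![IdxType.lS]
def siglV : Fin 1 → IdxType := ![IdxType.lV]
def sigU : Fin 1 → IdxType := ![IdxType.uS]
def sigV : Fin 1 → IdxType := ![IdxType.uV]
def sigUlS : Fin 2 → IdxType := ![IdxType.uS, IdxType.lS]
def sigUlV : Fin 2 → IdxType := ![IdxType.uS, IdxType.lV]
def sigVlS : Fin 2 → IdxType := ![IdxType.uV, IdxType.lS]
def sigVlV : Fin 2 → IdxType := ![IdxType.uV, IdxType.lV]
def sigRvsp : Fin 3 → IdxType := ![IdxType.uV, IdxType.lS, IdxType.lS]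
def sigPvsp : Fin 3 → IdxType := ![IdxType.uV, IdxType.lS, IdxType.lV]
def sigRc1 : Fin 3 → IdxType := ![IdxType.uS, IdxType.lS, IdxType.lS]
def sigRc : Fin 4 → IdxType := ![IdxType.uS, IdxType.lS, IdxType.lS, IdxType.lS]
def sigPc1 : Fin 3 → IdxType := ![IdxType.uS, IdxType.lS, IdxType.lV]
def sigPc : Fin 4 → IdxType := ![IdxType.uS, IdxType.lS, IdxType.lS, IdxType.lV]
def sigSc : Fin 4 → IdxType := ![IdxType.uS, IdxType.lS, IdxType.lV, IdxType.lV]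

end Jet

namespace Jet

theorem dx_neg {n : ℕ} (N : Fin n → Fin n → Fn n) (k : Fin n) (F : Fn n) :
    dx N k (-F) = -dx N k F := by
  funext t x y
  simp [dx, px, py]
  ring

/-- The temporal curvature plus `(Tˡ₁ⱼ)_{|k}` reduces to terms without `G`. -/
theorem Rc1_add_covX_T1T {n : ℕ} (M : Fin n → Fn n) (N : Fin n → Fin n → Fn n) (Γ : Conn n)
    (l j k : Fin n) :
    Rc1 M N Γ l j k + covX N Γ sigUlS k (T1T Γ) ![l, j]
      = -dt M (Γ.L l j k) + ∑ r, Γ.C l j r * Rv1 M N r k := by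
  have hu : ∀ r, Function.update ![l, j] 0 r = ![r, j] := fun r => by
    ext q; fin_cases q <;> simp
  have hl : ∀ r, Function.update ![l, j] 1 r = ![l, r] := fun r => by
    ext q; fin_cases q <;> simp
  have hG : ∑ r, Γ.L r j k * Γ.G l r = ∑ r, Γ.G l r * Γ.L r j k :=
    sum_congr rfl fun r _ => mul_comm _ _
  simp only [Rc1, covX, T1T, T1, Fin.sum_univ_two, sigUlS, Matrix.cons_val_zero,
    Matrix.cons_val_one, hu, hl, dx_neg, neg_mul, sum_neg_distrib, hG]
  abel

/-- local Bianchi identities for an h-normal Γ-linear connection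
of Cartan type. -/
theorem bianchi_identities_1_2
    (n : ℕ) (hn : 1 ≤ n)
    (h : ℝ → ℝ) (hh : ContDiff ℝ (⊤ : ℕ∞) h) (hhpos : ∀ t, 0 < h t)
    (M : Fin n → Fn n) (N : Fin n → Fin n → Fn n) (Γ : Conn n)
    (hκ : Γ.κ = chr h)
    (hMs : ∀ i, Smooth (M i)) (hNs : ∀ i j, Smooth (N i j))
    (hGs : ∀ k i, Smooth (Γ.G k i)) (hLs : ∀ k i j, Smooth (Γ.L k i j))
    (hCs : ∀ k i j, Smooth (Γ.C k i j))
    (hLsym : ∀ k i j, Γ.L k i j = Γ.L k j i) (hCsym : ∀ k i j, Γ.C k i j = Γ.C k j i) :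
    (∀ l j k,
      (Rc1 M N Γ l j k + covX N Γ sigUlS k (T1T Γ) ![l, j]
          + (∑ r, Rv1 M N r j * Γ.C l k r))
        - (Rc1 M N Γ l k j + covX N Γ sigUlS j (T1T Γ) ![l, k]
          + (∑ r, Rv1 M N r k * Γ.C l j r)) = 0)
    ∧ (∀ l i j k,
      (Rc M N Γ l i j k - (∑ r, Rvsp M N r i j * Γ.C l k r))
        + (Rc M N Γ l j k i - (∑ r, Rvsp M N r j k * Γ.C l i r))
        + (Rc M N Γ l k i j - (∑ r, Rvsp M N r k i * Γ.C l j r)) = 0) := by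
  constructor
  · intro l j k
    have hC : ∀ a b, ∑ r, Rv1 M N r a * Γ.C l b r = ∑ r, Γ.C l b r * Rv1 M N r a :=
      fun a b => sum_congr rfl fun r _ => mul_comm _ _
    rw [Rc1_add_covX_T1T, Rc1_add_covX_T1T, hLsym l k j, hC, hC]
    abel
  · intro l i j k
    have hC : ∀ a b c, ∑ r, Rvsp M N r a b * Γ.C l c r = ∑ r, Γ.C l c r * Rvsp M N r a b :=
      fun a b c => sum_congr rfl fun r _ => mul_comm _ _
    simp only [Rc, hC, hLsym _ j i, hLsym _ k i, hLsym _ k j]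
    abel

end Jet
end
end

section
/- For every h-normal Γ-linear connection of Cartan type, the following local Bianchi identities hold for all indices l, i, j, k: (3) A_{j,k}{ (Rv^l_1j)_|k + T^r_1j Rv^l_kr + Rv^r_1j Pv^l_kr } = −(Rv^l_jk)_/1 − Rv^r_jk Pv^l_1r, and (4) Σ_{i,j,k}{ (Rv^l_ij)_|k + Rv^r_ij Pv^l_kr } = 0. -/
open Finset

noncomputable section

namespace Jet

variable {n : ℕ}

/-- A function on the jet space as a function of a single variable. -/
def uncurried (F : Fn n) : ℝ × (Fin n → ℝ) × (Fin n → ℝ) → ℝ := fun p => F p.1 p.2.1 p.2.2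

/-- The directional derivative along a constant vector `v`. -/
def pd (v : ℝ × (Fin n → ℝ) × (Fin n → ℝ)) (F : Fn n) : Fn n :=
  fun t x y => fderiv ℝ (uncurried F) (t, x, y) v

/-- The constant vector `∂/∂yʳ`. -/
def ey (r : Fin n) : ℝ × (Fin n → ℝ) × (Fin n → ℝ) := (0, 0, Pi.single r 1)

/-- The vector field `v − Aʳ ∂/∂yʳ` acting on functions. -/
def ad (v : ℝ × (Fin n → ℝ) × (Fin n → ℝ)) (A : Fin n → Fn n) (F : Fn n) : Fn n :=
  pd v F - ∑ r, A r * pd (ey r) F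

namespace Smooth

variable {F G : Fn n}

lemma contDiff (hF : Smooth F) : ContDiff ℝ (⊤ : ℕ∞) (uncurried F) := hF

lemma differentiable (hF : Smooth F) : Differentiable ℝ (uncurried F) :=
  hF.contDiff.differentiable (by simp)

lemma hasFDerivAt (hF : Smooth F) (p) :
    HasFDerivAt (uncurried F) (fderiv ℝ (uncurried F) p) p :=
  (hF.differentiable p).hasFDerivAt

lemma pd (hF : Smooth F) (v) : Smooth (pd v F) :=
  (hF.contDiff.fderiv_right (m := (⊤ : ℕ∞)) (by simp)).clm_apply contDiff_const

lemma sub (hF : Smooth F) (hG : Smooth G) : Smooth (F - G) := ContDiff.sub hF hG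

lemma mul (hF : Smooth F) (hG : Smooth G) : Smooth (F * G) := ContDiff.mul hF hG

lemma sum {ι : Type*} (s : Finset ι) {f : ι → Fn n} (hf : ∀ i, Smooth (f i)) :
    Smooth (∑ i ∈ s, f i) := by
  simp only [Smooth, Finset.sum_apply]
  exact ContDiff.sum fun i _ => hf i

lemma ad (hF : Smooth F) (v) {A : Fin n → Fn n} (hA : ∀ r, Smooth (A r)) :
    Smooth (ad v A F) :=
  (hF.pd v).sub (sum _ fun r => (hA r).mul (hF.pd _))

end Smooth

variable {F G : Fn n}

lemma pt_eq_pd (hF : Smooth F) : pt F = pd (1, 0, 0) F := by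
  funext t x y
  exact ((hF.hasFDerivAt (t, x, y)).comp_hasDerivAt t
    ((hasDerivAt_id t).prodMk ((hasDerivAt_const t x).prodMk (hasDerivAt_const t y)))).deriv

lemma px_eq_pd (i : Fin n) (hF : Smooth F) : px i F = pd (0, Pi.single i 1, 0) F := by
  funext t x y
  exact ((show HasFDerivAt _ _ (t, Function.update x i (x i), y) by
    simpa using hF.hasFDerivAt (t, x, y)).comp_hasDerivAt (x i)
    ((hasDerivAt_const _ t).prodMk
      ((hasDerivAt_update x i (x i)).prodMk (hasDerivAt_const _ y)))).deriv

lemma py_eq_pd (i : Fin n) (hF : Smooth F) : py i F = pd (ey i) F := by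
  funext t x y
  exact ((show HasFDerivAt _ _ (t, x, Function.update y i (y i)) by
    simpa using hF.hasFDerivAt (t, x, y)).comp_hasDerivAt (y i)
    ((hasDerivAt_const _ t).prodMk
      ((hasDerivAt_const _ x).prodMk (hasDerivAt_update y i (y i))))).deriv

lemma dt_eq_ad (M : Fin n → Fn n) (hF : Smooth F) : dt M F = ad (1, 0, 0) M F := by
  simp only [dt, ad, pt_eq_pd hF, py_eq_pd _ hF]

lemma dx_eq_ad (N : Fin n → Fin n → Fn n) (k : Fin n) (hF : Smooth F) :
    dx N k F = ad (0, Pi.single k 1, 0) (fun r => N r k) F := by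
  simp only [dx, ad, px_eq_pd k hF, py_eq_pd _ hF]

lemma pd_sub (v) (hF : Smooth F) (hG : Smooth G) : pd v (F - G) = pd v F - pd v G := by
  funext t x y
  exact congrArg (· v) ((hF.hasFDerivAt (t, x, y)).sub (hG.hasFDerivAt (t, x, y))).fderiv

lemma pd_mul (v) (hF : Smooth F) (hG : Smooth G) :
    pd v (F * G) = pd v F * G + F * pd v G := by
  funext t x y
  refine (congrArg (· v)
    ((hF.hasFDerivAt (t, x, y)).mul (hG.hasFDerivAt (t, x, y))).fderiv).trans ?_
  simp [pd, uncurried]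
  ring

lemma pd_sum (v) {ι : Type*} (s : Finset ι) {f : ι → Fn n} (hf : ∀ i, Smooth (f i)) :
    pd v (∑ i ∈ s, f i) = ∑ i ∈ s, pd v (f i) := by
  funext t x y
  have hu : uncurried (∑ i ∈ s, f i) = ∑ i ∈ s, uncurried (f i) := by
    funext p
    simp [uncurried]
  simp only [pd, hu, Finset.sum_apply]
  rw [(HasFDerivAt.sum fun i _ => (hf i).hasFDerivAt (t, x, y)).fderiv]
  simp

lemma pd_comm (v w) (hF : Smooth F) : pd v (pd w F) = pd w (pd v F) := by
  have key : ∀ (a b) (p : ℝ × (Fin n → ℝ) × (Fin n → ℝ)),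
      fderiv ℝ (uncurried (pd b F)) p a = fderiv ℝ (fderiv ℝ (uncurried F)) p a b := by
    intro a b p
    have hd : DifferentiableAt ℝ (fderiv ℝ (uncurried F)) p :=
      ((hF.contDiff.fderiv_right (m := (⊤ : ℕ∞)) (by simp)).differentiable (by simp)) p
    refine (congrArg (· a)
      (hd.hasFDerivAt.clm_apply (hasFDerivAt_const b p)).fderiv).trans ?_
    simp
  funext t x y
  have hsymm : IsSymmSndFDerivAt ℝ (uncurried F) (t, x, y) :=
    hF.contDiff.contDiffAt.isSymmSndFDerivAt
      (by simpa using WithTop.coe_le_coe.2 (le_top (a := (2 : ℕ∞))))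
  exact (key v w _).trans ((hsymm v w).trans (key w v _).symm)

lemma ad_sub (v) (A : Fin n → Fn n) (hF : Smooth F) (hG : Smooth G) :
    ad v A (F - G) = ad v A F - ad v A G := by
  simp only [ad, pd_sub _ hF hG, mul_sub, Finset.sum_sub_distrib]
  ring

lemma ad_ad (v w) (A : Fin n → Fn n) {B : Fin n → Fn n} (hB : ∀ r, Smooth (B r))
    (hF : Smooth F) :
    ad v A (ad w B F) = pd v (pd w F) - ∑ r, A r * pd (ey r) (pd w F)
      - ∑ r, ad v A (B r) * pd (ey r) F - ∑ r, B r * pd v (pd (ey r) F)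
      + ∑ r, ∑ s, A s * B r * pd (ey s) (pd (ey r) F) := by
  have hBF : ∀ r, Smooth (B r * pd (ey r) F) := fun r => (hB r).mul (hF.pd _)
  have hpd : ∀ u, pd u (ad w B F) = pd u (pd w F)
      - ∑ r, (pd u (B r) * pd (ey r) F + B r * pd u (pd (ey r) F)) := by
    intro u
    rw [ad, pd_sub u (hF.pd w) (Smooth.sum _ hBF), pd_sum u _ hBF]
    simp only [pd_mul u (hB _) (hF.pd _)]
  rw [ad]
  simp only [hpd, mul_sub, Finset.mul_sum, Finset.sum_sub_distrib]
  rw [Finset.sum_comm (f := fun s r => A s *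
    (pd (ey s) (B r) * pd (ey r) F + B r * pd (ey s) (pd (ey r) F)))]
  simp only [ad, sub_mul, mul_add, Finset.sum_mul, Finset.sum_sub_distrib,
    Finset.sum_add_distrib, mul_assoc]
  ring

/-- The commutator of two adapted vector fields is vertical. -/
lemma ad_commutator (v w) {A B : Fin n → Fn n} (hA : ∀ r, Smooth (A r))
    (hB : ∀ r, Smooth (B r)) (hF : Smooth F) :
    ad v A (ad w B F) - ad w B (ad v A F)
      = ∑ r, (ad w B (A r) - ad v A (B r)) * pd (ey r) F := by
  have hdouble : ∑ r, ∑ s, A s * B r * pd (ey s) (pd (ey r) F)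
      = ∑ r, ∑ s, B s * A r * pd (ey s) (pd (ey r) F) := by
    rw [Finset.sum_comm]
    refine Finset.sum_congr rfl fun r _ => Finset.sum_congr rfl fun s _ => ?_
    rw [pd_comm _ _ hF]
    ring
  rw [ad_ad v w A hB hF, ad_ad w v B hA hF, hdouble, pd_comm v w hF]
  simp only [pd_comm v (ey _) hF, pd_comm w (ey _) hF, sub_mul, Finset.sum_sub_distrib]
  ring

section NonlinearConnection

variable {M : Fin n → Fn n} {N : Fin n → Fin n → Fn n}

lemma Smooth.dt (hM : ∀ i, Smooth (M i)) (hF : Smooth F) : Smooth (dt M F) :=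
  dt_eq_ad M hF ▸ hF.ad _ hM

lemma Smooth.dx (hN : ∀ i j, Smooth (N i j)) (k : Fin n) (hF : Smooth F) :
    Smooth (dx N k F) :=
  dx_eq_ad N k hF ▸ hF.ad _ fun r => hN r k

lemma dt_sub (hF : Smooth F) (hG : Smooth G) : dt M (F - G) = dt M F - dt M G := by
  rw [dt_eq_ad M (hF.sub hG), dt_eq_ad M hF, dt_eq_ad M hG, ad_sub _ _ hF hG]

lemma dx_sub (k : Fin n) (hF : Smooth F) (hG : Smooth G) :
    dx N k (F - G) = dx N k F - dx N k G := by
  rw [dx_eq_ad N k (hF.sub hG), dx_eq_ad N k hF, dx_eq_ad N k hG, ad_sub _ _ hF hG]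

lemma dx_commutator (hN : ∀ i j, Smooth (N i j)) (j k : Fin n) (hF : Smooth F) :
    dx N j (dx N k F) - dx N k (dx N j F) = ∑ r, Rvsp M N r j k * py r F := by
  rw [dx_eq_ad N j (hF.dx hN k), dx_eq_ad N k (hF.dx hN j)]
  simp only [Rvsp, dx_eq_ad N _ (hN _ _), dx_eq_ad N _ hF, py_eq_pd _ hF]
  exact ad_commutator _ _ (fun r => hN r j) (fun r => hN r k) hF

lemma dt_dx_commutator (hM : ∀ i, Smooth (M i)) (hN : ∀ i j, Smooth (N i j)) (k : Fin n)
    (hF : Smooth F) :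
    dt M (dx N k F) - dx N k (dt M F) = ∑ r, Rv1 M N r k * py r F := by
  rw [dx_eq_ad N k (hF.dt hM), dt_eq_ad M (hF.dx hN k)]
  simp only [Rv1, dx_eq_ad N _ (hM _), dt_eq_ad M (hN _ _), dx_eq_ad N _ hF, dt_eq_ad M hF,
    py_eq_pd _ hF]
  exact ad_commutator _ _ hM (fun r => hN r k) hF

lemma Rvsp_antisymm (l i j : Fin n) : Rvsp M N l i j = -Rvsp M N l j i := by
  simp only [Rvsp, neg_sub]

end NonlinearConnection

lemma covX_Rv1T (M : Fin n → Fn n) (N : Fin n → Fin n → Fn n) (Γ : Conn n) (l j k : Fin n) :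
    covX N Γ sigVlS k (Rv1T M N) ![l, j] = dx N k (Rv1 M N l j)
      + ∑ r, Rv1 M N r j * Γ.L l r k - ∑ r, Rv1 M N l r * Γ.L r j k := by
  simp [covX, sigVlS, Rv1T, Fin.sum_univ_succ]
  ring

lemma covX_RvspT (M : Fin n → Fn n) (N : Fin n → Fin n → Fn n) (Γ : Conn n)
    (l i j k : Fin n) :
    covX N Γ sigRvsp k (RvspT M N) ![l, i, j] = dx N k (Rvsp M N l i j)
      + ∑ r, Rvsp M N r i j * Γ.L l r k - ∑ r, Rvsp M N l r j * Γ.L r i k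
      - ∑ r, Rvsp M N l i r * Γ.L r j k := by
  simp [covX, sigRvsp, RvspT, Fin.sum_univ_succ]
  ring

lemma covT_RvspT (M : Fin n → Fn n) (N : Fin n → Fin n → Fn n) (Γ : Conn n)
    (l j k : Fin n) :
    covT M Γ 0 sigRvsp (RvspT M N) ![l, j, k] = dt M (Rvsp M N l j k)
      + ∑ r, Rvsp M N r j k * (Γ.G l r - kron l r * Γ.κ)
      - ∑ r, Rvsp M N l r k * Γ.G r j - ∑ r, Rvsp M N l j r * Γ.G r k := by
  simp [covT, sigRvsp, RvspT, Fin.sum_univ_succ]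
  ring

/-- local Bianchi identities for an h-normal Γ-linear connection
of Cartan type. -/
theorem bianchi_identities_3_4
    (n : ℕ) (hn : 1 ≤ n)
    (h : ℝ → ℝ) (hh : ContDiff ℝ (⊤ : ℕ∞) h) (hhpos : ∀ t, 0 < h t)
    (M : Fin n → Fn n) (N : Fin n → Fin n → Fn n) (Γ : Conn n)
    (hκ : Γ.κ = chr h)
    (hMs : ∀ i, Smooth (M i)) (hNs : ∀ i j, Smooth (N i j))
    (hGs : ∀ k i, Smooth (Γ.G k i)) (hLs : ∀ k i j, Smooth (Γ.L k i j))
    (hCs : ∀ k i j, Smooth (Γ.C k i j))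
    (hLsym : ∀ k i j, Γ.L k i j = Γ.L k j i) (hCsym : ∀ k i j, Γ.C k i j = Γ.C k j i) :
    (∀ l j k,
      ((covX N Γ sigVlS k (Rv1T M N) ![l, j]
          + (∑ r, T1 Γ r j * Rvsp M N l k r)
          + (∑ r, Rv1 M N r j * Pvsp N Γ l k r))
        - (covX N Γ sigVlS j (Rv1T M N) ![l, k]
          + (∑ r, T1 Γ r k * Rvsp M N l j r)
          + (∑ r, Rv1 M N r k * Pvsp N Γ l j r)))
      = -covT M Γ 0 sigRvsp (RvspT M N) ![l, j, k]
        - (∑ r, Rvsp M N r j k * Pv1 M Γ l r))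
    ∧ (∀ l i j k,
      (covX N Γ sigRvsp k (RvspT M N) ![l, i, j]
          + (∑ r, Rvsp M N r i j * Pvsp N Γ l k r))
        + (covX N Γ sigRvsp i (RvspT M N) ![l, j, k]
          + (∑ r, Rvsp M N r j k * Pvsp N Γ l i r))
        + (covX N Γ sigRvsp j (RvspT M N) ![l, k, i]
          + (∑ r, Rvsp M N r k i * Pvsp N Γ l j r)) = 0) := by
  refine ⟨fun l j k => ?_, fun l i j k => ?_⟩
  · have hMM := dx_commutator (M := M) hNs j k (hMs l)
    have hNj := dt_dx_commutator hMs hNs k (hNs l j)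
    have hNk := dt_dx_commutator hMs hNs j (hNs l k)
    have hGj : ∑ r, T1 Γ r j * Rvsp M N l k r = ∑ r, Rvsp M N l r k * Γ.G r j :=
      Finset.sum_congr rfl fun r _ => by
        rw [Rvsp_antisymm l k r, T1]
        ring
    have hGk : ∑ r, T1 Γ r k * Rvsp M N l j r = -∑ r, Rvsp M N l j r * Γ.G r k := by
      rw [← Finset.sum_neg_distrib]
      exact Finset.sum_congr rfl fun r _ => by
        rw [T1]
        ring
    have hL : ∑ r, Rv1 M N l r * Γ.L r j k = ∑ r, Rv1 M N l r * Γ.L r k j :=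
      Finset.sum_congr rfl fun r _ => by rw [hLsym r j k]
    have hX : ∀ a b, dx N b (Rv1 M N l a) = dx N b (dx N a (M l)) - dx N b (dt M (N l a)) :=
      fun a b => dx_sub b ((hMs l).dx hNs a) ((hNs l a).dt hMs)
    have hT : dt M (Rvsp M N l j k) = dt M (dx N k (N l j)) - dt M (dx N j (N l k)) :=
      dt_sub ((hNs l j).dx hNs k) ((hNs l k).dx hNs j)
    rw [covX_Rv1T, covX_Rv1T, covT_RvspT, hX, hX, hT, hGj, hGk, hL]
    simp only [Pvsp, Pv1, mul_sub, mul_add, Finset.sum_sub_distrib, Finset.sum_add_distrib]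
    linear_combination hNj - hNk - hMM
  · have hNi := dx_commutator (M := M) hNs j k (hNs l i)
    have hNj := dx_commutator (M := M) hNs k i (hNs l j)
    have hNk := dx_commutator (M := M) hNs i j (hNs l k)
    have hX : ∀ a b c, dx N c (Rvsp M N l a b)
        = dx N c (dx N b (N l a)) - dx N c (dx N a (N l b)) :=
      fun a b c => dx_sub c ((hNs l a).dx hNs b) ((hNs l b).dx hNs a)
    have hL : ∀ a b c, ∑ r, Rvsp M N l r a * Γ.L r b c = -∑ r, Rvsp M N l a r * Γ.L r c b := by
      intro a b c
      rw [← Finset.sum_neg_distrib]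
      exact Finset.sum_congr rfl fun r _ => by
        rw [Rvsp_antisymm l r a, hLsym r b c]
        ring
    simp only [covX_RvspT, hX, hL, Pvsp, mul_sub, Finset.sum_sub_distrib]
    linear_combination -hNi - hNj - hNk

end Jet
end
end

section
/- For every h-normal Γ-linear connection of Cartan type, the following local Bianchi identities hold for all indices l, j, k, p: (5) (T^l_1k)|_(p) − C^l_rp T^r_1k + P^l_k1(p) + (C^l_kp)_/1 + C^r_kp T^l_1r − C^l_kr Pv^r_1p = 0, and (6) A_{j,k}{ (C^l_jp)_|k + C^l_kr Pv^r_jp + P^l_jk(p) } = 0. -/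
open Finset

noncomputable section

namespace Jet

theorem py_neg {n : ℕ} (i : Fin n) (F : Fn n) : py i (-F) = -py i F := by
  funext t x y
  exact deriv.fun_neg

/-- The vertical covariant derivative of the torsion `Tˡ₁ₖ`. -/
theorem covY_T1T {n : ℕ} (Γ : Conn n) (l k p : Fin n) :
    covY Γ sigUlS p (T1T Γ) ![l, k] =
      -py p (Γ.G l k) + ∑ r, Γ.C l r p * T1 Γ r k - ∑ r, Γ.C r k p * T1 Γ l r := by
  simp [covY, sigUlS, T1T, T1, py_neg, Fin.sum_univ_two, mul_comm]
  ring

/-- local Bianchi identities for an h-normal Γ-linear connection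
of Cartan type. -/
theorem bianchi_identities_5_6
    (n : ℕ) (hn : 1 ≤ n)
    (h : ℝ → ℝ) (hh : ContDiff ℝ (⊤ : ℕ∞) h) (hhpos : ∀ t, 0 < h t)
    (M : Fin n → Fn n) (N : Fin n → Fin n → Fn n) (Γ : Conn n)
    (hκ : Γ.κ = chr h)
    (hMs : ∀ i, Smooth (M i)) (hNs : ∀ i j, Smooth (N i j))
    (hGs : ∀ k i, Smooth (Γ.G k i)) (hLs : ∀ k i j, Smooth (Γ.L k i j))
    (hCs : ∀ k i j, Smooth (Γ.C k i j))
    (hLsym : ∀ k i j, Γ.L k i j = Γ.L k j i) (hCsym : ∀ k i j, Γ.C k i j = Γ.C k j i) :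
    (∀ l k p,
      covY Γ sigUlS p (T1T Γ) ![l, k]
        - (∑ r, Γ.C l r p * T1 Γ r k)
        + Pc1 M N Γ l k p
        + covT M Γ 0 sigC (CT Γ) ![l, k, p]
        + (∑ r, Γ.C r k p * T1 Γ l r)
        - (∑ r, Γ.C l k r * Pv1 M Γ r p) = 0)
    ∧ (∀ l j k p,
      ((covX N Γ sigC k (CT Γ) ![l, j, p]
          + (∑ r, Γ.C l k r * Pvsp N Γ r j p)
          + Pc M N Γ l j k p)
        - (covX N Γ sigC j (CT Γ) ![l, k, p]
          + (∑ r, Γ.C l j r * Pvsp N Γ r k p)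
          + Pc M N Γ l k j p)) = 0) := by
  refine ⟨fun l k p => ?_, fun l j k p => ?_⟩
  · rw [covY_T1T, Pc1]
    ring
  · rw [Pc, Pc, hLsym l j k]
    ring

end Jet
end
end

section
/- For every h-normal Γ-linear connection of Cartan type, the following local Bianchi identities hold for all indices l, i, j, k: (9) A_{j,k}{ (C^l_ij)|_(k) + C^r_ik C^l_rj } = S^l_i(j)(k), and (12) Σ_{i,j,k} S^l_i(j)(k) = 0. -/
open Finset

noncomputable section

namespace Jet

/-- The explicit form of the vertical covariant derivative of `Cˡᵢⱼ`. -/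
lemma covY_CT {n : ℕ} (Γ : Conn n) (l i j k : Fin n) :
    covY Γ sigC k (CT Γ) ![l, i, j]
      = py k (Γ.C l i j) + (∑ r, Γ.C r i j * Γ.C l r k - ∑ r, Γ.C l r j * Γ.C r i k
        - ∑ r, Γ.C l i r * Γ.C r j k) := by
  simp [covY, CT, sigC, Fin.sum_univ_three, Function.update, sub_eq_add_neg]

/-- local Bianchi identities for an h-normal Γ-linear connection
of Cartan type. -/
theorem bianchi_identities_9_12
    (n : ℕ) (hn : 1 ≤ n)
    (h : ℝ → ℝ) (hh : ContDiff ℝ (⊤ : ℕ∞) h) (hhpos : ∀ t, 0 < h t)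
    (M : Fin n → Fn n) (N : Fin n → Fin n → Fn n) (Γ : Conn n)
    (hκ : Γ.κ = chr h)
    (hMs : ∀ i, Smooth (M i)) (hNs : ∀ i j, Smooth (N i j))
    (hGs : ∀ k i, Smooth (Γ.G k i)) (hLs : ∀ k i j, Smooth (Γ.L k i j))
    (hCs : ∀ k i j, Smooth (Γ.C k i j))
    (hLsym : ∀ k i j, Γ.L k i j = Γ.L k j i) (hCsym : ∀ k i j, Γ.C k i j = Γ.C k j i) :
    (∀ l i j k,
      ((covY Γ sigC k (CT Γ) ![l, i, j] + (∑ r, Γ.C r i k * Γ.C l r j))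
        - (covY Γ sigC j (CT Γ) ![l, i, k] + (∑ r, Γ.C r i j * Γ.C l r k)))
      = Sc Γ l i j k)
    ∧ (∀ l i j k,
      Sc Γ l i j k + Sc Γ l j k i + Sc Γ l k i j = 0) := by
  refine ⟨fun l i j k => ?_, fun l i j k => ?_⟩
  · simp only [covY_CT, mul_comm (Γ.C l _ _), Sc, hCsym _ k j]
    abel
  · simp only [Sc, hCsym _ j i, hCsym _ k i, hCsym _ k j]
    abel

end Jet
end
end

section
/- For every h-normal Γ-linear connection of Cartan type, the following local Bianchi identities hold for all indices l, i, j, k, p: (13) A_{j,k}{ (R^l_p1j)_|k + T^r_1j R^l_pkr + Rv^r_1j P^l_pk(r) } = −(R^l_pjk)_/1 − Rv^r_jk P^l_p1(r), and (14) Σ_{i,j,k}{ (R^l_pij)_|k + Rv^r_ij P^l_pk(r) } = 0. -/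
open Finset

noncomputable section

namespace Jet

variable {n : ℕ}

/-! ### An algebraic Bianchi identity -/

section Abstract

variable {ι ρ A E : Type*} [Fintype ρ] [CommRing A] [Ring E] [Algebra A E]

/-- The curvature of the connection `Λ` along a non-holonomic frame `D` whose brackets have
coefficients `Rv` in the vertical directions, corrected by the vertical connection `C`. -/
def curv (D : ι → E →+ E) (Rv : ρ → ι → ι → A) (Λ : ι → E) (C : ρ → E) (b c : ι) : E :=
  D c (Λ b) - D b (Λ c) + Λ c * Λ b - Λ b * Λ c + ∑ r, Rv r b c • C r

/-- The mixed (horizontal-vertical) curvature. -/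
def mixedCurv (D : ι → E →+ E) (V : ρ → E →+ E) (ν : ρ → ι → ρ → A) (Λ : ι → E) (C : ρ → E)
    (a : ι) (r : ρ) : E :=
  V r (Λ a) - D a (C r) - (Λ a * C r - C r * Λ a) + ∑ s, ν s a r • C s

theorem curv_swap (D : ι → E →+ E) (Rv : ρ → ι → ι → A) (hRv : ∀ r a b, Rv r a b = -Rv r b a)
    (Λ : ι → E) (C : ρ → E) (b c : ι) : curv D Rv Λ C b c = -curv D Rv Λ C c b := by
  have : ∑ r, Rv r b c • C r = -∑ r, Rv r c b • C r := by
    rw [← Finset.sum_neg_distrib]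
    exact Finset.sum_congr rfl fun r _ => by rw [hRv r b c, neg_smul]
  unfold curv
  rw [this]
  abel

/-- The covariant derivative of the curvature along the frame, plus the vertical correction
term. -/
def bianchiTerm (D : ι → E →+ E) (V : ρ → E →+ E) (Rv : ρ → ι → ι → A) (ν : ρ → ι → ρ → A)
    (Λ : ι → E) (C : ρ → E) (a b c : ι) : E :=
  D a (curv D Rv Λ C b c) + Λ a * curv D Rv Λ C b c - curv D Rv Λ C b c * Λ a
    + ∑ r, Rv r b c • mixedCurv D V ν Λ C a r

theorem bianchiTerm_swap (D : ι → E →+ E) (V : ρ → E →+ E) (Rv : ρ → ι → ι → A)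
    (ν : ρ → ι → ρ → A) (hRv : ∀ r a b, Rv r a b = -Rv r b a) (Λ : ι → E) (C : ρ → E)
    (a b c : ι) : bianchiTerm D V Rv ν Λ C a b c = -bianchiTerm D V Rv ν Λ C a c b := by
  have : ∑ r, Rv r b c • mixedCurv D V ν Λ C a r = -∑ r, Rv r c b • mixedCurv D V ν Λ C a r := by
    rw [← Finset.sum_neg_distrib]
    exact Finset.sum_congr rfl fun r _ => by rw [hRv r b c, neg_smul]
  rw [bianchiTerm, bianchiTerm, this, curv_swap D Rv hRv Λ C b c, map_neg, mul_neg, neg_mul]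
  abel

theorem bianchiTerm_cyclic (d : ι → A → A) (D : ι → E →+ E) (V : ρ → E →+ E)
    (Rv : ρ → ι → ι → A) (ν : ρ → ι → ρ → A) (Λ : ι → E) (C : ρ → E)
    (hmul : ∀ a x y, D a (x * y) = D a x * y + x * D a y)
    (hsmul : ∀ a (f : A) x, D a (f • x) = d a f • x + f • D a x)
    (hcomm : ∀ a b x, D a (D b x) - D b (D a x) = ∑ r, Rv r a b • V r x)
    (hRv : ∀ a b c s,
      (d a (Rv s b c) + ∑ r, Rv r b c * ν s a r) + (d b (Rv s c a) + ∑ r, Rv r c a * ν s b r)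
        + (d c (Rv s a b) + ∑ r, Rv r a b * ν s c r) = 0)
    (a b c : ι) :
    bianchiTerm D V Rv ν Λ C a b c + bianchiTerm D V Rv ν Λ C b c a
      + bianchiTerm D V Rv ν Λ C c a b = 0 := by
  have key : ∀ a b c : ι, bianchiTerm D V Rv ν Λ C a b c
      = D a (D c (Λ b)) - D a (D b (Λ c)) + (D b (D c (Λ a)) - D c (D b (Λ a)))
        + (D a (Λ c) * Λ b + Λ c * D a (Λ b)) - (D a (Λ b) * Λ c + Λ b * D a (Λ c))
        + Λ a * (D c (Λ b) - D b (Λ c) + Λ c * Λ b - Λ b * Λ c)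
        - (D c (Λ b) - D b (Λ c) + Λ c * Λ b - Λ b * Λ c) * Λ a
        + ∑ s, (d a (Rv s b c) + ∑ r, Rv r b c * ν s a r) • C s := by
    intro a b c
    have hν : ∑ s, (∑ r, Rv r b c * ν s a r) • C s = ∑ r, Rv r b c • ∑ s, ν s a r • C s := by
      simp only [Finset.sum_smul, Finset.smul_sum, mul_smul]
      exact Finset.sum_comm
    rw [hcomm b c (Λ a)]
    simp only [bianchiTerm, curv, mixedCurv, map_add, map_sub, map_sum, hmul, hsmul, add_smul,
      smul_add, smul_sub, Finset.sum_add_distrib, Finset.sum_sub_distrib, hν, mul_add, add_mul,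
      Finset.mul_sum, Finset.sum_mul, mul_smul_comm, smul_mul_assoc]
    abel
  have hC : ∑ s, (d a (Rv s b c) + ∑ r, Rv r b c * ν s a r) • C s
      + ∑ s, (d b (Rv s c a) + ∑ r, Rv r c a * ν s b r) • C s
      + ∑ s, (d c (Rv s a b) + ∑ r, Rv r a b * ν s c r) • C s = 0 := by
    simp only [← Finset.sum_add_distrib, ← add_smul, hRv, zero_smul, Finset.sum_const_zero]
  rw [key a b c, key b c a, key c a b, ← sub_eq_zero.mpr hC]
  noncomm_ring

end Abstract

/-! ### Adapted frames of derivations -/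

section Frame

variable {R ι ρ A : Type*} [CommRing R] [CommRing A] [Algebra R A]

/-- Entrywise application of a derivation to a matrix. -/
def matDer (d : Derivation R A A) : Matrix ρ ρ A →+ Matrix ρ ρ A :=
  (d : A →+ A).mapMatrix

theorem matDer_apply (d : Derivation R A A) (Y : Matrix ρ ρ A) (i j : ρ) :
    matDer d Y i j = d (Y i j) := rfl

theorem matDer_mul [Fintype ρ] (d : Derivation R A A) (Y Z : Matrix ρ ρ A) :
    matDer d (Y * Z) = matDer d Y * Z + Y * matDer d Z := by
  refine Matrix.ext fun i j => ?_
  simp only [matDer_apply, Matrix.mul_apply, Matrix.add_apply, map_sum, Derivation.leibniz,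
    smul_eq_mul, Finset.sum_add_distrib]
  rw [add_comm]
  simp only [mul_comm]

theorem matDer_smul (d : Derivation R A A) (f : A) (Y : Matrix ρ ρ A) :
    matDer d (f • Y) = d f • Y + f • matDer d Y := by
  refine Matrix.ext fun i j => ?_
  simp only [matDer_apply, Matrix.smul_apply, Matrix.add_apply, Derivation.leibniz, smul_eq_mul]
  ring

variable [Fintype ρ] (X : ι → Derivation R A A) (V : ρ → Derivation R A A) (H : ρ → ι → A)

/-- The derivations adapted to the nonlinear connection `H`. -/
def horiz (a : ι) : Derivation R A A := X a - ∑ r, H r a • V r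

/-- The curvature of the nonlinear connection `H`. -/
def horizCurv (r : ρ) (a b : ι) : A := horiz X V H b (H r a) - horiz X V H a (H r b)

theorem horiz_apply (a : ι) (f : A) : horiz X V H a f = X a f - ∑ r, H r a * V r f := by
  have : (∑ r, H r a • V r) f = ∑ r, H r a * V r f := by
    rw [← Derivation.coeFnAddMonoidHom_apply, map_sum, Finset.sum_apply]
    rfl
  rw [horiz, Derivation.sub_apply, this]

theorem horizCurv_swap (r : ρ) (a b : ι) : horizCurv X V H r a b = -horizCurv X V H r b a := by
  simp [horizCurv]

variable {X V}

theorem horiz_comm (hXX : ∀ a b f, X a (X b f) = X b (X a f))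
    (hXV : ∀ a r f, X a (V r f) = V r (X a f)) (hVV : ∀ r s f, V r (V s f) = V s (V r f))
    (a b : ι) (f : A) :
    horiz X V H a (horiz X V H b f) - horiz X V H b (horiz X V H a f)
      = ∑ r, horizCurv X V H r a b * V r f := by
  have e : ∀ a b : ι, horiz X V H a (horiz X V H b f)
      = X a (X b f) - ∑ r, H r a * V r (X b f)
        - (∑ s, horiz X V H a (H s b) * V s f + ∑ s, H s b * V s (X a f))
        + ∑ r, ∑ s, H r a * H s b * V r (V s f) := by
    intro a b
    have hv : ∀ s, horiz X V H a (V s f) = V s (X a f) - ∑ r, H r a * V r (V s f) :=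
      fun s => by rw [horiz_apply, hXV]
    have h1 : ∀ s r, H s b * (H r a * V r (V s f)) = H r a * H s b * V r (V s f) :=
      fun s r => by ring
    have h2 : ∀ s, V s f * horiz X V H a (H s b) = horiz X V H a (H s b) * V s f :=
      fun s => mul_comm _ _
    rw [horiz_apply X V H b f, map_sub, map_sum, horiz_apply X V H a (X b f),
      Finset.sum_comm (f := fun r s => H r a * H s b * V r (V s f))]
    simp only [Derivation.leibniz, smul_eq_mul, hv, mul_sub, Finset.mul_sum,
      Finset.sum_add_distrib, Finset.sum_sub_distrib, h1, h2]
    ring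
  have hs : ∑ r, ∑ s, H r b * H s a * V r (V s f)
      = ∑ r, ∑ s, H r a * H s b * V r (V s f) := by
    rw [Finset.sum_comm]
    refine Finset.sum_congr rfl fun r _ => Finset.sum_congr rfl fun s _ => ?_
    rw [hVV s r]
    ring
  rw [e a b, e b a, hs, hXX b a]
  simp only [horizCurv, sub_mul, Finset.sum_sub_distrib]
  ring

theorem horizCurv_bianchi (hXX : ∀ a b f, X a (X b f) = X b (X a f))
    (hXV : ∀ a r f, X a (V r f) = V r (X a f)) (hVV : ∀ r s f, V r (V s f) = V s (V r f))
    (a b c : ι) (s : ρ) :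
    (horiz X V H a (horizCurv X V H s b c) + ∑ r, horizCurv X V H r b c * V r (H s a))
      + (horiz X V H b (horizCurv X V H s c a) + ∑ r, horizCurv X V H r c a * V r (H s b))
      + (horiz X V H c (horizCurv X V H s a b) + ∑ r, horizCurv X V H r a b * V r (H s c))
      = 0 := by
  rw [← horiz_comm H hXX hXV hVV, ← horiz_comm H hXX hXV hVV, ← horiz_comm H hXX hXV hVV]
  simp only [horizCurv, map_sub]
  ring

theorem matDer_horiz_comm (hXX : ∀ a b f, X a (X b f) = X b (X a f))
    (hXV : ∀ a r f, X a (V r f) = V r (X a f)) (hVV : ∀ r s f, V r (V s f) = V s (V r f))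
    (a b : ι) (Y : Matrix ρ ρ A) :
    matDer (horiz X V H a) (matDer (horiz X V H b) Y)
        - matDer (horiz X V H b) (matDer (horiz X V H a) Y)
      = ∑ r, horizCurv X V H r a b • matDer (V r) Y := by
  refine Matrix.ext fun i j => ?_
  simp only [Matrix.sub_apply, matDer_apply, Matrix.sum_apply, Matrix.smul_apply, smul_eq_mul]
  exact horiz_comm H hXX hXV hVV a b (Y i j)

variable (X V)
variable [DecidableEq ρ]

/-- The curvature matrices of the linear connection `(Λ, C)` in an adapted frame. -/
def frameCurv (Λ : ι → Matrix ρ ρ A) (C : ρ → Matrix ρ ρ A) : ι → ι → Matrix ρ ρ A :=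
  curv (fun a => matDer (horiz X V H a)) (horizCurv X V H) Λ C

/-- The mixed curvature matrices of the linear connection `(Λ, C)` in an adapted frame. -/
def frameMixed (Λ : ι → Matrix ρ ρ A) (C : ρ → Matrix ρ ρ A) : ι → ρ → Matrix ρ ρ A :=
  mixedCurv (fun a => matDer (horiz X V H a)) (fun r => matDer (V r))
    (fun s a r => V r (H s a)) Λ C

/-- The cyclic summand of the Bianchi identity in an adapted frame. -/
def frameTerm (Λ : ι → Matrix ρ ρ A) (C : ρ → Matrix ρ ρ A) : ι → ι → ι → Matrix ρ ρ A :=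
  bianchiTerm (fun a => matDer (horiz X V H a)) (fun r => matDer (V r)) (horizCurv X V H)
    (fun s a r => V r (H s a)) Λ C

theorem frameTerm_apply (Λ : ι → Matrix ρ ρ A) (C : ρ → Matrix ρ ρ A) (a b c : ι) (l p : ρ) :
    frameTerm X V H Λ C a b c l p
      = horiz X V H a (frameCurv X V H Λ C b c l p)
        + ∑ r, Λ a l r * frameCurv X V H Λ C b c r p
        - ∑ r, frameCurv X V H Λ C b c l r * Λ a r p
        + ∑ r, horizCurv X V H r b c * frameMixed X V H Λ C a r l p := by
  simp only [frameTerm, bianchiTerm, Matrix.add_apply, Matrix.sub_apply, Matrix.sum_apply,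
    Matrix.mul_apply, Matrix.smul_apply, matDer_apply, smul_eq_mul, frameCurv, frameMixed]

theorem frameCurv_apply (Λ : ι → Matrix ρ ρ A) (C : ρ → Matrix ρ ρ A) (b c : ι) (l i : ρ) :
    frameCurv X V H Λ C b c l i
      = horiz X V H c (Λ b l i) - horiz X V H b (Λ c l i) + ∑ r, Λ c l r * Λ b r i
        - ∑ r, Λ b l r * Λ c r i + ∑ r, horizCurv X V H r b c * C r l i := by
  simp only [frameCurv, curv, Matrix.add_apply, Matrix.sub_apply, Matrix.sum_apply,
    Matrix.mul_apply, Matrix.smul_apply, matDer_apply, smul_eq_mul]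

theorem frameMixed_apply (Λ : ι → Matrix ρ ρ A) (C : ρ → Matrix ρ ρ A) (a : ι) (k l i : ρ) :
    frameMixed X V H Λ C a k l i
      = V k (Λ a l i) - horiz X V H a (C k l i)
        - (∑ r, Λ a l r * C k r i - ∑ r, C k l r * Λ a r i)
        + ∑ s, V k (H s a) * C s l i := by
  simp only [frameMixed, mixedCurv, Matrix.add_apply, Matrix.sub_apply, Matrix.sum_apply,
    Matrix.mul_apply, Matrix.smul_apply, matDer_apply, smul_eq_mul]

theorem frameTerm_swap (Λ : ι → Matrix ρ ρ A) (C : ρ → Matrix ρ ρ A) (a b c : ι) :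
    frameTerm X V H Λ C a b c = -frameTerm X V H Λ C a c b :=
  bianchiTerm_swap _ _ _ _ (horizCurv_swap X V H) Λ C a b c

theorem frameTerm_swap_apply (Λ : ι → Matrix ρ ρ A) (C : ρ → Matrix ρ ρ A) (a b c : ι)
    (l p : ρ) : frameTerm X V H Λ C a b c l p = -frameTerm X V H Λ C a c b l p := by
  rw [frameTerm_swap, Matrix.neg_apply]

variable {X V}

theorem frameTerm_cyclic (hXX : ∀ a b f, X a (X b f) = X b (X a f))
    (hXV : ∀ a r f, X a (V r f) = V r (X a f)) (hVV : ∀ r s f, V r (V s f) = V s (V r f))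
    (Λ : ι → Matrix ρ ρ A) (C : ρ → Matrix ρ ρ A) (a b c : ι) :
    frameTerm X V H Λ C a b c + frameTerm X V H Λ C b c a + frameTerm X V H Λ C c a b = 0 :=
  bianchiTerm_cyclic (fun a => horiz X V H a) _ _ _ _ _ _ (fun _ => matDer_mul _)
    (fun _ => matDer_smul _) (matDer_horiz_comm H hXX hXV hVV)
    (horizCurv_bianchi H hXX hXV hVV) a b c

theorem frameTerm_cyclic_apply (hXX : ∀ a b f, X a (X b f) = X b (X a f))
    (hXV : ∀ a r f, X a (V r f) = V r (X a f)) (hVV : ∀ r s f, V r (V s f) = V s (V r f))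
    (Λ : ι → Matrix ρ ρ A) (C : ρ → Matrix ρ ρ A) (a b c : ι) (l p : ρ) :
    frameTerm X V H Λ C a b c l p + frameTerm X V H Λ C b c a l p
      + frameTerm X V H Λ C c a b l p = 0 := by
  rw [← Matrix.add_apply, ← Matrix.add_apply, frameTerm_cyclic H hXX hXV hVV, Matrix.zero_apply]

end Frame

/-! ### Smooth functions and their derivations -/

/-- The function on `ℝ × ℝⁿ × ℝⁿ` underlying a function of `(t, x, y)`. -/
def unc (F : Fn n) : ℝ × (Fin n → ℝ) × (Fin n → ℝ) → ℝ := fun p => F p.1 p.2.1 p.2.2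

/-- The algebra of smooth functions of `(t, x, y)`. -/
def smoothAlg (n : ℕ) : Subalgebra ℝ (Fn n) where
  carrier := {F | Smooth F}
  mul_mem' {F G} hF hG := show Smooth (F * G) from ContDiff.mul (f := unc F) (g := unc G) hF hG
  add_mem' {F G} hF hG := show Smooth (F + G) from ContDiff.add (f := unc F) (g := unc G) hF hG
  algebraMap_mem' c := show Smooth (fun _ _ _ => c) from contDiff_const

theorem smoothAlg_contDiff (f : smoothAlg n) : ContDiff ℝ (⊤ : ℕ∞) (unc f.1) := f.2

theorem smoothAlg_differentiable (f : smoothAlg n) : Differentiable ℝ (unc f.1) :=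
  (smoothAlg_contDiff f).differentiable (by simp)

/-- Differentiation in the constant direction `v`. -/
def dir (v : ℝ × (Fin n → ℝ) × (Fin n → ℝ)) : Derivation ℝ (smoothAlg n) (smoothAlg n) :=
  Derivation.mk'
    { toFun := fun f => ⟨fun t x y => fderiv ℝ (unc f.1) (t, x, y) v,
        ((smoothAlg_contDiff f).fderiv_right (m := (⊤ : ℕ∞)) (by simp)).clm_apply
          contDiff_const⟩
      map_add' := fun f g => by
        ext t x y
        exact congrArg (fun φ => φ v) (fderiv_add (smoothAlg_differentiable f (t, x, y))
          (smoothAlg_differentiable g (t, x, y)))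
      map_smul' := fun c f => by
        ext t x y
        exact congrArg (fun φ => φ v)
          (fderiv_const_smul (smoothAlg_differentiable f (t, x, y)) c) }
    fun f g => by
      ext t x y
      exact congrArg (fun φ => φ v) (fderiv_mul (smoothAlg_differentiable f (t, x, y))
          (smoothAlg_differentiable g (t, x, y)))

theorem dir_apply (v : ℝ × (Fin n → ℝ) × (Fin n → ℝ)) (f : smoothAlg n) (t : ℝ)
    (x y : Fin n → ℝ) : (dir v f).1 t x y = fderiv ℝ (unc f.1) (t, x, y) v := rfl

theorem dir_comm (v w : ℝ × (Fin n → ℝ) × (Fin n → ℝ)) (f : smoothAlg n) :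
    dir v (dir w f) = dir w (dir v f) := by
  have h2 : ∀ (v w : ℝ × (Fin n → ℝ) × (Fin n → ℝ)) p,
      fderiv ℝ (unc (dir w f).1) p v = fderiv ℝ (fderiv ℝ (unc f.1)) p v w := by
    intro v w p
    have hd : DifferentiableAt ℝ (fderiv ℝ (unc f.1)) p :=
      ((smoothAlg_contDiff f).fderiv_right (m := (⊤ : ℕ∞)) (by simp)).differentiable (by simp) p
    have := fderiv_clm_apply hd (differentiableAt_const w)
    have e : unc (dir w f).1 = fun p => fderiv ℝ (unc f.1) p w := rfl
    rw [e, this]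
    simp
  ext t x y
  rw [dir_apply, dir_apply, h2, h2]
  have h2le : minSmoothness ℝ 2 ≤ ((⊤ : ℕ∞) : WithTop ℕ∞) := by
    rw [minSmoothness_of_isRCLikeNormedField]
    exact WithTop.coe_le_coe.mpr (le_top : (2 : ℕ∞) ≤ ⊤)
  exact ((smoothAlg_contDiff f).contDiffAt.isSymmSndFDerivAt h2le) v w

theorem pt_eq_dir (f : smoothAlg n) : pt f.1 = (dir (1, 0, 0) f).1 := by
  funext t x y
  have hc : HasDerivAt (fun s : ℝ => (s, x, y)) (1, 0, 0) t :=
    (hasDerivAt_id t).prodMk (hasDerivAt_const t (x, y))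
  exact ((smoothAlg_differentiable f (t, x, y)).hasFDerivAt.comp_hasDerivAt t hc).deriv

theorem px_eq_dir (i : Fin n) (f : smoothAlg n) :
    px i f.1 = (dir (0, Pi.single i 1, 0) f).1 := by
  funext t x y
  have hc : HasDerivAt (fun s : ℝ => (t, Function.update x i s, y)) (0, Pi.single i 1, 0) (x i) :=
    (hasDerivAt_const _ t).prodMk ((hasDerivAt_update x i (x i)).prodMk (hasDerivAt_const _ y))
  have hf := (smoothAlg_differentiable f (t, Function.update x i (x i), y)).hasFDerivAt
  have := (hf.comp_hasDerivAt (x i) hc).deriv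
  rw [Function.update_eq_self] at this
  exact this

theorem py_eq_dir (i : Fin n) (f : smoothAlg n) :
    py i f.1 = (dir (0, 0, Pi.single i 1) f).1 := by
  funext t x y
  have hc : HasDerivAt (fun s : ℝ => (t, x, Function.update y i s)) (0, 0, Pi.single i 1) (y i) :=
    (hasDerivAt_const _ t).prodMk ((hasDerivAt_const _ x).prodMk (hasDerivAt_update y i (y i)))
  have hf := (smoothAlg_differentiable f (t, x, Function.update y i (y i))).hasFDerivAt
  have := (hf.comp_hasDerivAt (y i) hc).deriv
  rw [Function.update_eq_self] at this
  exact this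

/-! ### The curvature of a connection on the jet space -/

/-- The coordinate direction on the base: `none` is time, `some i` is `xⁱ`. -/
def baseDir : Option (Fin n) → ℝ × (Fin n → ℝ) × (Fin n → ℝ)
  | none => (1, 0, 0)
  | some i => (0, Pi.single i 1, 0)

/-- The coordinate derivations on the base. -/
def baseDer (a : Option (Fin n)) : Derivation ℝ (smoothAlg n) (smoothAlg n) := dir (baseDir a)

/-- The vertical derivation `∂/∂yʳ`. -/
def vert (r : Fin n) : Derivation ℝ (smoothAlg n) (smoothAlg n) := dir (0, 0, Pi.single r 1)

/-- The nonlinear connection `(M, N)` as a family of smooth functions. -/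
def nonlin (M : Fin n → Fn n) (N : Fin n → Fin n → Fn n)
    (hM : ∀ i, Smooth (M i)) (hN : ∀ i j, Smooth (N i j)) (r : Fin n) :
    Option (Fin n) → smoothAlg n
  | none => ⟨M r, hM r⟩
  | some i => ⟨N r i, hN r i⟩

/-- The horizontal connection matrices `G` and `Lₖ`. -/
def horizMat (Γ : Conn n) (hG : ∀ k i, Smooth (Γ.G k i)) (hL : ∀ k i j, Smooth (Γ.L k i j)) :
    Option (Fin n) → Matrix (Fin n) (Fin n) (smoothAlg n)
  | none => fun l i => ⟨Γ.G l i, hG l i⟩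
  | some k => fun l i => ⟨Γ.L l i k, hL l i k⟩

/-- The vertical connection matrices `Cₖ`. -/
def vertMat (Γ : Conn n) (hC : ∀ k i j, Smooth (Γ.C k i j)) (k : Fin n) :
    Matrix (Fin n) (Fin n) (smoothAlg n) :=
  fun l i => ⟨Γ.C l i k, hC l i k⟩

section Components

variable (M : Fin n → Fn n) (N : Fin n → Fin n → Fn n) (Γ : Conn n)
  (hM : ∀ i, Smooth (M i)) (hN : ∀ i j, Smooth (N i j))
  (hG : ∀ k i, Smooth (Γ.G k i)) (hL : ∀ k i j, Smooth (Γ.L k i j))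
  (hC : ∀ k i j, Smooth (Γ.C k i j))

theorem dt_eq_horiz (f : smoothAlg n) :
    dt M f.1 = (horiz baseDer vert (nonlin M N hM hN) none f).1 := by
  rw [horiz_apply]
  simp only [dt, pt_eq_dir, py_eq_dir, AddSubgroupClass.coe_sub, AddSubmonoidClass.coe_finsetSum,
    MulMemClass.coe_mul]
  rfl

theorem dx_eq_horiz (k : Fin n) (f : smoothAlg n) :
    dx N k f.1 = (horiz baseDer vert (nonlin M N hM hN) (some k) f).1 := by
  rw [horiz_apply]
  simp only [dx, px_eq_dir, py_eq_dir, AddSubgroupClass.coe_sub, AddSubmonoidClass.coe_finsetSum,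
    MulMemClass.coe_mul]
  rfl

theorem Rv1_eq (r k : Fin n) :
    Rv1 M N r k = (horizCurv baseDer vert (nonlin M N hM hN) r none (some k)).1 := by
  rw [horizCurv, AddSubgroupClass.coe_sub, ← dt_eq_horiz, ← dx_eq_horiz]
  rfl

theorem Rvsp_eq (r j k : Fin n) :
    Rvsp M N r j k = (horizCurv baseDer vert (nonlin M N hM hN) r (some j) (some k)).1 := by
  rw [horizCurv, AddSubgroupClass.coe_sub, ← dx_eq_horiz, ← dx_eq_horiz]
  rfl

theorem Rc1_eq (l i k : Fin n) :
    Rc1 M N Γ l i k = (frameCurv baseDer vert (nonlin M N hM hN) (horizMat Γ hG hL) (vertMat Γ hC)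
      none (some k) l i).1 := by
  simp only [frameCurv_apply, AddMemClass.coe_add,
    AddSubgroupClass.coe_sub, AddSubmonoidClass.coe_finsetSum, MulMemClass.coe_mul,
    ← dt_eq_horiz, ← dx_eq_horiz, ← Rv1_eq]
  simp only [Rc1, horizMat, vertMat, mul_comm]

theorem Rc_eq (l i j k : Fin n) :
    Rc M N Γ l i j k = (frameCurv baseDer vert (nonlin M N hM hN) (horizMat Γ hG hL) (vertMat Γ hC)
      (some j) (some k) l i).1 := by
  simp only [frameCurv_apply, AddMemClass.coe_add,
    AddSubgroupClass.coe_sub, AddSubmonoidClass.coe_finsetSum, MulMemClass.coe_mul,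
    ← dx_eq_horiz, ← Rvsp_eq]
  simp only [Rc, horizMat, vertMat, mul_comm]

theorem Pc1_eq (l i k : Fin n) :
    Pc1 M N Γ l i k = (frameMixed baseDer vert (nonlin M N hM hN) (horizMat Γ hG hL) (vertMat Γ hC)
      none k l i).1 := by
  simp only [frameMixed_apply, AddMemClass.coe_add,
    AddSubgroupClass.coe_sub, AddSubmonoidClass.coe_finsetSum, MulMemClass.coe_mul,
    ← dt_eq_horiz, vert, ← py_eq_dir]
  simp only [Pc1, covT, Pv1, CT, sigC, horizMat, vertMat, nonlin, Fin.sum_univ_three]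
  simp [mul_add, mul_sub, Finset.sum_add_distrib, Finset.sum_sub_distrib, mul_comm]
  ring

theorem Pc_eq (l i j k : Fin n) :
    Pc M N Γ l i j k = (frameMixed baseDer vert (nonlin M N hM hN) (horizMat Γ hG hL) (vertMat Γ hC)
      (some j) k l i).1 := by
  simp only [frameMixed_apply, AddMemClass.coe_add,
    AddSubgroupClass.coe_sub, AddSubmonoidClass.coe_finsetSum, MulMemClass.coe_mul,
    ← dx_eq_horiz, vert, ← py_eq_dir]
  simp only [Pc, covX, Pvsp, CT, sigC, horizMat, vertMat, nonlin, Fin.sum_univ_three]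
  simp [mul_sub, Finset.sum_sub_distrib, mul_comm]
  ring

theorem Rc_swap (l i j k : Fin n) : Rc M N Γ l i j k = -Rc M N Γ l i k j := by
  unfold Rc
  have : ∀ r, Rvsp M N r j k = -Rvsp M N r k j := fun r => by simp [Rvsp]
  simp only [this, mul_neg, Finset.sum_neg_distrib]
  ring

/-- The entries of the cyclic Bianchi summand of a connection on the jet space. -/
def jetTerm (a b c : Option (Fin n)) (l p : Fin n) : Fn n :=
  (frameTerm baseDer vert (nonlin M N hM hN) (horizMat Γ hG hL) (vertMat Γ hC) a b c l p).1

theorem jetTerm_swap (a b c : Option (Fin n)) (l p : Fin n) :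
    jetTerm M N Γ hM hN hG hL hC a b c l p = -jetTerm M N Γ hM hN hG hL hC a c b l p :=
  congrArg Subtype.val (frameTerm_swap_apply baseDer vert (nonlin M N hM hN) (horizMat Γ hG hL)
    (vertMat Γ hC) a b c l p)

theorem jetTerm_cyclic (a b c : Option (Fin n)) (l p : Fin n) :
    jetTerm M N Γ hM hN hG hL hC a b c l p + jetTerm M N Γ hM hN hG hL hC b c a l p
      + jetTerm M N Γ hM hN hG hL hC c a b l p = 0 :=
  congrArg Subtype.val (frameTerm_cyclic_apply (nonlin M N hM hN) (fun _ _ => dir_comm _ _)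
    (fun _ _ => dir_comm _ _) (fun _ _ => dir_comm _ _) (horizMat Γ hG hL) (vertMat Γ hC) a b c l p)

theorem covX_Rc (l p i j k : Fin n) :
    covX N Γ sigRc k (RcT M N Γ) ![l, p, i, j] + (∑ r, Rvsp M N r i j * Pc M N Γ l p k r)
      = jetTerm M N Γ hM hN hG hL hC (some k) (some i) (some j) l p
        - (∑ r, Rc M N Γ l p r j * Γ.L r i k) - ∑ r, Rc M N Γ l p i r * Γ.L r j k := by
  simp only [jetTerm, frameTerm_apply, AddMemClass.coe_add,
    AddSubgroupClass.coe_sub, AddSubmonoidClass.coe_finsetSum, MulMemClass.coe_mul,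
    ← dx_eq_horiz, ← Rc_eq, ← Pc_eq, ← Rvsp_eq]
  simp only [covX, RcT, sigRc, horizMat, Fin.sum_univ_four]
  simp [mul_comm]
  ring

theorem covX_Rc1 (l p j k : Fin n) :
    covX N Γ sigRc1 k (Rc1T M N Γ) ![l, p, j] + (∑ r, Rv1 M N r j * Pc M N Γ l p k r)
      = jetTerm M N Γ hM hN hG hL hC (some k) none (some j) l p
        - (∑ r, Rc1 M N Γ l p r * Γ.L r j k) := by
  simp only [jetTerm, frameTerm_apply, AddMemClass.coe_add,
    AddSubgroupClass.coe_sub, AddSubmonoidClass.coe_finsetSum, MulMemClass.coe_mul,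
    ← dx_eq_horiz, ← Rc1_eq, ← Pc_eq, ← Rv1_eq]
  simp only [covX, Rc1T, sigRc1, horizMat, Fin.sum_univ_three]
  simp [mul_comm]
  ring

theorem covT_Rc (l p j k : Fin n) :
    covT M Γ 0 sigRc (RcT M N Γ) ![l, p, j, k] + (∑ r, Rvsp M N r j k * Pc1 M N Γ l p r)
      = jetTerm M N Γ hM hN hG hL hC none (some j) (some k) l p
        - (∑ r, Rc M N Γ l p r k * Γ.G r j) - ∑ r, Rc M N Γ l p j r * Γ.G r k := by
  simp only [jetTerm, frameTerm_apply, AddMemClass.coe_add,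
    AddSubgroupClass.coe_sub, AddSubmonoidClass.coe_finsetSum, MulMemClass.coe_mul,
    ← dt_eq_horiz, ← Rc_eq, ← Pc1_eq, ← Rvsp_eq]
  simp only [covT, RcT, sigRc, horizMat, Fin.sum_univ_four]
  simp [mul_comm]
  ring

end Components

end Jet

namespace Jet

/-- local Bianchi identities for an h-normal Γ-linear connection
of Cartan type. -/
theorem bianchi_identities_13_14
    (n : ℕ) (hn : 1 ≤ n)
    (h : ℝ → ℝ) (hh : ContDiff ℝ (⊤ : ℕ∞) h) (hhpos : ∀ t, 0 < h t)
    (M : Fin n → Fn n) (N : Fin n → Fin n → Fn n) (Γ : Conn n)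
    (hκ : Γ.κ = chr h)
    (hMs : ∀ i, Smooth (M i)) (hNs : ∀ i j, Smooth (N i j))
    (hGs : ∀ k i, Smooth (Γ.G k i)) (hLs : ∀ k i j, Smooth (Γ.L k i j))
    (hCs : ∀ k i j, Smooth (Γ.C k i j))
    (hLsym : ∀ k i j, Γ.L k i j = Γ.L k j i) (hCsym : ∀ k i j, Γ.C k i j = Γ.C k j i) :
    (∀ l p j k,
      ((covX N Γ sigRc1 k (Rc1T M N Γ) ![l, p, j]
          + (∑ r, T1 Γ r j * Rc M N Γ l p k r)
          + (∑ r, Rv1 M N r j * Pc M N Γ l p k r))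
        - (covX N Γ sigRc1 j (Rc1T M N Γ) ![l, p, k]
          + (∑ r, T1 Γ r k * Rc M N Γ l p j r)
          + (∑ r, Rv1 M N r k * Pc M N Γ l p j r)))
      = -covT M Γ 0 sigRc (RcT M N Γ) ![l, p, j, k]
        - (∑ r, Rvsp M N r j k * Pc1 M N Γ l p r))
    ∧ (∀ l p i j k,
      (covX N Γ sigRc k (RcT M N Γ) ![l, p, i, j]
          + (∑ r, Rvsp M N r i j * Pc M N Γ l p k r))
        + (covX N Γ sigRc i (RcT M N Γ) ![l, p, j, k]
          + (∑ r, Rvsp M N r j k * Pc M N Γ l p i r))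
        + (covX N Γ sigRc j (RcT M N Γ) ![l, p, k, i]
          + (∑ r, Rvsp M N r k i * Pc M N Γ l p j r)) = 0) := by
  refine ⟨fun l p j k => ?_, fun l p i j k => ?_⟩
  · have hcyc := jetTerm_cyclic M N Γ hMs hNs hGs hLs hCs none (some j) (some k) l p
    rw [jetTerm_swap M N Γ hMs hNs hGs hLs hCs (some j) (some k) none] at hcyc
    have hj := covX_Rc1 M N Γ hMs hNs hGs hLs hCs l p j k
    have hk := covX_Rc1 M N Γ hMs hNs hGs hLs hCs l p k j
    have ht := covT_Rc M N Γ hMs hNs hGs hLs hCs l p j k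
    have hsym : ∑ r, Rc1 M N Γ l p r * Γ.L r k j = ∑ r, Rc1 M N Γ l p r * Γ.L r j k :=
      Finset.sum_congr rfl fun r _ => by rw [hLsym r k j]
    have hT : ∑ r, T1 Γ r j * Rc M N Γ l p k r = ∑ r, Rc M N Γ l p r k * Γ.G r j :=
      Finset.sum_congr rfl fun r _ => by rw [Rc_swap M N Γ l p k r, T1]; ring
    have hT' : ∑ r, T1 Γ r k * Rc M N Γ l p j r = -∑ r, Rc M N Γ l p j r * Γ.G r k := by
      rw [← Finset.sum_neg_distrib]
      exact Finset.sum_congr rfl fun r _ => by rw [T1]; ring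
    rw [hT, hT']
    linear_combination hj - hk + ht + hcyc + hsym
  · have hcyc := jetTerm_cyclic M N Γ hMs hNs hGs hLs hCs (some k) (some i) (some j) l p
    have hsym : ∀ i j k, ∑ r, Rc M N Γ l p r j * Γ.L r i k = -∑ r, Rc M N Γ l p j r * Γ.L r k i :=
      fun i j k => by
        rw [← Finset.sum_neg_distrib]
        exact Finset.sum_congr rfl fun r _ => by rw [Rc_swap M N Γ l p r j, hLsym r i k]; ring
    rw [covX_Rc M N Γ hMs hNs hGs hLs hCs, covX_Rc M N Γ hMs hNs hGs hLs hCs,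
      covX_Rc M N Γ hMs hNs hGs hLs hCs, hsym i j k, hsym j k i, hsym k i j]
    linear_combination hcyc

end Jet
end
end
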